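/- For nonzero a1, a2 in ℂ with a1 ≠ a2, the Leibniz algebras L2(a1) and L2(a2) are isomorphic if and only if a1·a2 = 1. Moreover, the remaining algebras in the list L1, L3, L4, L5(a) (a ≠ 0), L6 are pairwise non-isomorphic: no two of L1, L3, L4, L6 are isomorphic, L5(a1) is isomorphic to L5(a2) only if a1 = a2, and no algebra from {L1, L3, L4, L6} or the family L5 is isomorphic to any L2(a) or to an algebra of a different type in the list. -/

import Mathlib

noncomputable def zrow : Fin 3 → Fin 3 → ℂ := ![![0,0,0], ![0,0,0], ![0,0,0]]

/-- bilinear extension of structure constants `c` to a bracket on `Fin 3 → ℂ`;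
`c i j` is the value of the bracket of the `i`-th and `j`-th basis vectors. -/
noncomputable def brOf (c : Fin 3 → Fin 3 → Fin 3 → ℂ) (u v : Fin 3 → ℂ) : Fin 3 → ℂ :=
  ∑ i : Fin 3, ∑ j : Fin 3, (u i * v j) • c i j

/-- L1 : [x,x]=z, [x,z]=y, [x,y]=y -/
noncomputable def L1c : Fin 3 → Fin 3 → Fin 3 → ℂ := ![![![0,0,1], ![0,1,0], ![0,1,0]], zrow, zrow]

/-- L2(a) : [x,z]=a z, [x,y]=y -/
noncomputable def L2c (a : ℂ) : Fin 3 → Fin 3 → Fin 3 → ℂ := ![![![0,0,0], ![0,1,0], ![0,0,a]], zrow, zrow]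

/-- L3 : [x,z]=y, [x,y]=-(1/4)z+y -/
noncomputable def L3c : Fin 3 → Fin 3 → Fin 3 → ℂ := ![![![0,0,0], ![0,1,-(1/4)], ![0,1,0]], zrow, zrow]

/-- L4 : [x,x]=z, [x,y]=y, [y,x]=-y -/
noncomputable def L4c : Fin 3 → Fin 3 → Fin 3 → ℂ :=
  ![![![0,0,1], ![0,1,0], ![0,0,0]], ![![0,-1,0], ![0,0,0], ![0,0,0]], zrow]

/-- L5(a) : [x,z]=a z, [x,y]=y, [y,x]=-y -/
noncomputable def L5c (a : ℂ) : Fin 3 → Fin 3 → Fin 3 → ℂ :=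
  ![![![0,0,0], ![0,1,0], ![0,0,a]], ![![0,-1,0], ![0,0,0], ![0,0,0]], zrow]

/-- L6 : [x,x]=z, [x,y]=y, [y,x]=-y, [x,z]=2z, [y,y]=z -/
noncomputable def L6c : Fin 3 → Fin 3 → Fin 3 → ℂ :=
  ![![![0,0,1], ![0,1,0], ![0,0,2]], ![![0,-1,0], ![0,0,1], ![0,0,0]], zrow]

/-- isomorphism of (Leibniz) brackets: a bijective linear map preserving the bracket -/
noncomputable def LeibIso (f g : (Fin 3 → ℂ) → (Fin 3 → ℂ) → (Fin 3 → ℂ)) : Prop :=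
  ∃ e : (Fin 3 → ℂ) ≃ₗ[ℂ] (Fin 3 → ℂ), ∀ u v, e (f u v) = g (e u) (e v)

/-- The bracket `brOf c` as a bilinear map. -/
noncomputable def brLin (c : Fin 3 → Fin 3 → Fin 3 → ℂ) :
    (Fin 3 → ℂ) →ₗ[ℂ] (Fin 3 → ℂ) →ₗ[ℂ] (Fin 3 → ℂ) :=
  LinearMap.mk₂ ℂ (brOf c)
    (fun u v w => by simp [brOf, add_mul, add_smul, Finset.sum_add_distrib])
    (fun k u v => by simp [brOf, Finset.smul_sum, mul_assoc, mul_smul])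
    (fun u v w => by simp [brOf, mul_add, add_smul, Finset.sum_add_distrib])
    (fun k u v => by simp [brOf, Finset.smul_sum, mul_left_comm, mul_smul])

@[simp]
lemma brLin_apply (c : Fin 3 → Fin 3 → Fin 3 → ℂ) (u v : Fin 3 → ℂ) :
    brLin c u v = brOf c u v := rfl

/-- The traces of left multiplication by `u`, its square, and right multiplication by `u` are
`p * u 0`, `q * u 0 ^ 2` and `r * u 0`. -/
structure HasTraces (c : Fin 3 → Fin 3 → Fin 3 → ℂ) (p q r : ℂ) : Prop where
  left (u : Fin 3 → ℂ) : LinearMap.trace ℂ _ (brLin c u) = p * u 0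
  left_sq (u : Fin 3 → ℂ) : LinearMap.trace ℂ _ (brLin c u ∘ₗ brLin c u) = q * u 0 ^ 2
  right (u : Fin 3 → ℂ) : LinearMap.trace ℂ _ ((brLin c).flip u) = r * u 0

lemma trace_eq_sum_apply_single (f : (Fin 3 → ℂ) →ₗ[ℂ] (Fin 3 → ℂ)) :
    LinearMap.trace ℂ _ f = ∑ i, f (Pi.single i 1) i := by
  simp [LinearMap.trace_eq_matrix_trace ℂ (Pi.basisFun ℂ (Fin 3)), Matrix.trace]

lemma hasTraces_L1c : HasTraces L1c 1 1 0 := by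
  constructor <;> intro u <;>
    simp [trace_eq_sum_apply_single, brOf, L1c, zrow, Fin.sum_univ_three]
  ring

lemma hasTraces_L2c (a : ℂ) : HasTraces (L2c a) (1 + a) (1 + a ^ 2) 0 := by
  constructor <;> intro u <;>
    simp [trace_eq_sum_apply_single, brOf, L2c, zrow, Fin.sum_univ_three] <;> ring

lemma hasTraces_L3c : HasTraces L3c 1 (1 / 2) 0 := by
  constructor <;> intro u <;>
    simp [trace_eq_sum_apply_single, brOf, L3c, zrow, Fin.sum_univ_three]
  ring

lemma hasTraces_L4c : HasTraces L4c 1 1 (-1) := by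
  constructor <;> intro u <;>
    simp [trace_eq_sum_apply_single, brOf, L4c, zrow, Fin.sum_univ_three]
  ring

lemma hasTraces_L5c (a : ℂ) : HasTraces (L5c a) (1 + a) (1 + a ^ 2) (-1) := by
  constructor <;> intro u <;>
    simp [trace_eq_sum_apply_single, brOf, L5c, zrow, Fin.sum_univ_three] <;> ring

lemma hasTraces_L6c : HasTraces L6c 3 5 (-1) := by
  constructor <;> intro u <;>
    simp [trace_eq_sum_apply_single, brOf, L6c, zrow, Fin.sum_univ_three] <;> ring

lemma HasTraces.eq_of_equiv {c d : Fin 3 → Fin 3 → Fin 3 → ℂ} {p q r p' q' r' : ℂ}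
    (hc : HasTraces c p q r) (hd : HasTraces d p' q' r') (e : (Fin 3 → ℂ) ≃ₗ[ℂ] (Fin 3 → ℂ))
    (he : ∀ u v, e (brOf c u v) = brOf d (e u) (e v)) (u : Fin 3 → ℂ) :
    p * u 0 = p' * e u 0 ∧ q * u 0 ^ 2 = q' * e u 0 ^ 2 ∧ r * u 0 = r' * e u 0 := by
  have hl : e.conj (brLin c u) = brLin d (e u) := by
    refine LinearMap.ext fun v => ?_
    simp [LinearEquiv.conj_apply, he]
  have hr : e.conj ((brLin c).flip u) = (brLin d).flip (e u) := by
    refine LinearMap.ext fun v => ?_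
    simp [LinearEquiv.conj_apply, he]
  refine ⟨?_, ?_, ?_⟩
  · rw [← hc.left, ← hd.left, ← hl, LinearMap.trace_conj']
  · rw [← hc.left_sq, ← hd.left_sq, ← hl, ← LinearEquiv.conj_comp, LinearMap.trace_conj']
  · rw [← hc.right, ← hd.right, ← hr, LinearMap.trace_conj']

lemma LeibIso.exists_scale {c d : Fin 3 → Fin 3 → Fin 3 → ℂ} {p q r p' q' r' : ℂ}
    (h : LeibIso (brOf c) (brOf d)) (hc : HasTraces c p q r) (hd : HasTraces d p' q' r') :
    ∃ t : ℂ, p = p' * t ∧ q = q' * t ^ 2 ∧ r = r' * t := by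
  obtain ⟨e, he⟩ := h
  exact ⟨e (Pi.single 0 1) 0, by simpa using hc.eq_of_equiv hd e he (Pi.single 0 1)⟩

lemma leibIso_L2c_of_mul_eq_one {a b : ℂ} (h : a * b = 1) :
    LeibIso (brOf (L2c a)) (brOf (L2c b)) := by
  let f (k : ℂ) : (Fin 3 → ℂ) →ₗ[ℂ] (Fin 3 → ℂ) :=
    Matrix.toLin' !![k, 0, 0; 0, 0, 1; 0, 1, 0]
  have hf (k l : ℂ) (hkl : k * l = 1) : f k ∘ₗ f l = LinearMap.id := by
    rw [← Matrix.toLin'_mul, ← Matrix.toLin'_one]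
    congr 1
    ext i j
    fin_cases i <;> fin_cases j <;> simp [Matrix.mul_apply, Fin.sum_univ_three, hkl]
  refine ⟨LinearEquiv.ofLinearMap (f a) (f b) (hf a b h) (hf b a (by rwa [mul_comm])), ?_⟩
  intro u v
  ext i
  fin_cases i <;>
    simp [f, brOf, L2c, zrow, Fin.sum_univ_three, Matrix.mulVec, dotProduct] <;> grind

lemma mul_eq_one_of_leibIso_L2c {a b : ℂ} (hab : a ≠ b)
    (h : LeibIso (brOf (L2c a)) (brOf (L2c b))) : a * b = 1 := by
  obtain ⟨t, h₁, h₂, -⟩ := h.exists_scale (hasTraces_L2c a) (hasTraces_L2c b)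
  have h₃ : a = b * t ^ 2 := by linear_combination (h₂ - (1 + a + (1 + b) * t) * h₁) / (-2)
  have h₄ : (1 - t) * (1 - b * t) = 0 := by linear_combination h₁ - h₃
  rcases mul_eq_zero.mp h₄ with h₅ | h₅ <;> grind

lemma not_leibIso_L3c_L2c {a : ℂ} : ¬ LeibIso (brOf L3c) (brOf (L2c a)) := by
  intro h
  obtain ⟨t, h₁, h₂, -⟩ := h.exists_scale hasTraces_L3c (hasTraces_L2c a)
  have ha : a = 1 := by
    have : ((a - 1) * t) ^ 2 = 0 := by
      linear_combination (-2) * h₂ + (1 + (1 + a) * t) * h₁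
    grind
  subst ha
  obtain ⟨e, he⟩ := h
  have hsq (v w : Fin 3 → ℂ) : brOf (L2c 1) v (brOf (L2c 1) v w) = v 0 • brOf (L2c 1) v w := by
    ext i
    fin_cases i <;> simp [brOf, L2c, zrow, Fin.sum_univ_three]
  have h₃ := hsq (e ![1, 0, 0]) (e ![0, 0, 1])
  rw [← he, ← he, ← map_smul] at h₃
  simpa [brOf, L3c, zrow, Fin.sum_univ_three] using congrFun (e.injective h₃) 2

lemma not_leibIso_L6c_L5c {a : ℂ} : ¬ LeibIso (brOf L6c) (brOf (L5c a)) := by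
  rintro ⟨e, he⟩
  have h₁ : e ![0, 1, 0] 0 = 0 := by
    simpa using (hasTraces_L6c.eq_of_equiv (hasTraces_L5c a) e he ![0, 1, 0]).2.2
  have h₂ : brOf (L5c a) (e ![0, 1, 0]) (e ![0, 1, 0]) = 0 := by
    ext i
    fin_cases i <;> simp [brOf, L5c, zrow, Fin.sum_univ_three, h₁]
  rw [← he, map_eq_zero_iff e e.injective] at h₂
  simpa [brOf, L6c, zrow, Fin.sum_univ_three] using congrFun h₂ 2

theorem dim3_solvable_iso_classes :
    (∀ a₁ a₂ : ℂ, a₁ ≠ 0 → a₂ ≠ 0 → a₁ ≠ a₂ →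
      (LeibIso (brOf (L2c a₁)) (brOf (L2c a₂)) ↔ a₁ * a₂ = 1)) ∧
    (¬ LeibIso (brOf L1c) (brOf L3c)) ∧ (¬ LeibIso (brOf L1c) (brOf L4c)) ∧
    (¬ LeibIso (brOf L1c) (brOf L6c)) ∧ (¬ LeibIso (brOf L3c) (brOf L4c)) ∧
    (¬ LeibIso (brOf L3c) (brOf L6c)) ∧ (¬ LeibIso (brOf L4c) (brOf L6c)) ∧
    (∀ a₁ a₂ : ℂ, a₁ ≠ 0 → a₂ ≠ 0 → LeibIso (brOf (L5c a₁)) (brOf (L5c a₂)) → a₁ = a₂) ∧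
    (∀ a : ℂ, a ≠ 0 →
      (¬ LeibIso (brOf L1c) (brOf (L2c a))) ∧ (¬ LeibIso (brOf L3c) (brOf (L2c a))) ∧
      (¬ LeibIso (brOf L4c) (brOf (L2c a))) ∧ (¬ LeibIso (brOf L6c) (brOf (L2c a))) ∧
      (¬ LeibIso (brOf L1c) (brOf (L5c a))) ∧ (¬ LeibIso (brOf L3c) (brOf (L5c a))) ∧
      (¬ LeibIso (brOf L4c) (brOf (L5c a))) ∧ (¬ LeibIso (brOf L6c) (brOf (L5c a)))) ∧
    (∀ a₁ a₂ : ℂ, a₁ ≠ 0 → a₂ ≠ 0 → ¬ LeibIso (brOf (L5c a₁)) (brOf (L2c a₂))) := by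
  refine ⟨fun a₁ a₂ _ _ h => ⟨mul_eq_one_of_leibIso_L2c h, leibIso_L2c_of_mul_eq_one⟩,
    fun h => ?_, fun h => ?_, fun h => ?_, fun h => ?_, fun h => ?_, fun h => ?_,
    fun a₁ a₂ _ _ h => ?_,
    fun a ha => ⟨fun h => ?_, not_leibIso_L3c_L2c, fun h => ?_, fun h => ?_,
      fun h => ?_, fun h => ?_, fun h => ?_, not_leibIso_L6c_L5c⟩,
    fun a₁ a₂ _ _ h => ?_⟩
  · obtain ⟨t, h₁, h₂, h₃⟩ := h.exists_scale hasTraces_L1c hasTraces_L3c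
    grind
  · obtain ⟨t, h₁, h₂, h₃⟩ := h.exists_scale hasTraces_L1c hasTraces_L4c
    grind
  · obtain ⟨t, h₁, h₂, h₃⟩ := h.exists_scale hasTraces_L1c hasTraces_L6c
    grind
  · obtain ⟨t, h₁, h₂, h₃⟩ := h.exists_scale hasTraces_L3c hasTraces_L4c
    grind
  · obtain ⟨t, h₁, h₂, h₃⟩ := h.exists_scale hasTraces_L3c hasTraces_L6c
    grind
  · obtain ⟨t, h₁, h₂, h₃⟩ := h.exists_scale hasTraces_L4c hasTraces_L6c
    grind
  · obtain ⟨t, h₁, h₂, h₃⟩ := h.exists_scale (hasTraces_L5c a₁) (hasTraces_L5c a₂)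
    grind
  · obtain ⟨t, h₁, h₂, h₃⟩ := h.exists_scale hasTraces_L1c (hasTraces_L2c a)
    grind
  · obtain ⟨t, h₁, h₂, h₃⟩ := h.exists_scale hasTraces_L4c (hasTraces_L2c a)
    grind
  · obtain ⟨t, h₁, h₂, h₃⟩ := h.exists_scale hasTraces_L6c (hasTraces_L2c a)
    grind
  · obtain ⟨t, h₁, h₂, h₃⟩ := h.exists_scale hasTraces_L1c (hasTraces_L5c a)
    grind
  · obtain ⟨t, h₁, h₂, h₃⟩ := h.exists_scale hasTraces_L3c (hasTraces_L5c a)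
    grind
  · obtain ⟨t, h₁, h₂, h₃⟩ := h.exists_scale hasTraces_L4c (hasTraces_L5c a)
    grind
  · obtain ⟨t, h₁, h₂, h₃⟩ := h.exists_scale (hasTraces_L5c a₁) (hasTraces_L2c a₂)
    grind
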